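/- Each of the pairs (15,45), (15,49), (16,48), (17,54), (19,59), (23,69), (24,72), (27,83), (35,107) belongs to E^6; that is, for each such pair (p, q) there exists a 6-polytope with p vertices and q edges. -/

import Mathlib

open Set

/-- A polytope: the convex hull of a finite set of points. -/
def IsPolytope {n : ℕ} (P : Set (Fin n → ℝ)) : Prop :=
  ∃ S : Finset (Fin n → ℝ), P = convexHull ℝ (S : Set (Fin n → ℝ))

/-- The affine dimension of a set: the rank of its vector span. -/
noncomputable def adim {n : ℕ} (P : Set (Fin n → ℝ)) : ℕ :=
  Module.finrank ℝ (vectorSpan ℝ P)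

/-- A `d`-polytope: a polytope whose affine hull has dimension `d`. -/
def IsDPolytope (d : ℕ) {n : ℕ} (P : Set (Fin n → ℝ)) : Prop :=
  IsPolytope P ∧ adim P = d

/-- An edge of `P`: a face (an extreme convex subset) of affine dimension 1. -/
def IsEdge {n : ℕ} (P E : Set (Fin n → ℝ)) : Prop :=
  IsExtreme ℝ P E ∧ Convex ℝ E ∧ adim E = 1

/-- `f₀ P`: the number of vertices (extreme points) of `P`. -/
noncomputable def f₀ {n : ℕ} (P : Set (Fin n → ℝ)) : ℕ :=
  (Set.extremePoints ℝ P).ncard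

/-- `f₁ P`: the number of edges of `P`. -/
noncomputable def f₁ {n : ℕ} (P : Set (Fin n → ℝ)) : ℕ :=
  {E : Set (Fin n → ℝ) | IsEdge P E}.ncard

/-- `E^d`: the set of `(f₀, f₁)` pairs realized by `d`-polytopes. -/
def fPairs (d : ℕ) : Set (ℕ × ℕ) :=
  {p | ∃ (n : ℕ) (P : Set (Fin n → ℝ)), IsDPolytope d P ∧ f₀ P = p.1 ∧ f₁ P = p.2}

section Faces

variable {E : Type*} [AddCommGroup E] [Module ℝ E] {S F : Set E}

theorem eq_convexHull_inter_of_isExtreme (hF : IsExtreme ℝ (convexHull ℝ S) F)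
    (hconv : Convex ℝ F) : F = convexHull ℝ (F ∩ S) := by
  refine Subset.antisymm (fun x hx ↦ ?_) (convexHull_min inter_subset_left hconv)
  have key : convexHull ℝ S ⊆
      {y | y ∈ convexHull ℝ S ∧ (y ∈ F → y ∈ convexHull ℝ (F ∩ S))} := by
    refine convexHull_min
      (fun y hy ↦ ⟨subset_convexHull ℝ S hy, fun hyF ↦ subset_convexHull ℝ _ ⟨hyF, hy⟩⟩) ?_
    rw [convex_iff_openSegment_subset]
    rintro y ⟨hy, hyF⟩ z ⟨hz, hzF⟩ w hw
    refine ⟨(convex_convexHull ℝ S).openSegment_subset hy hz hw, fun hwF ↦ ?_⟩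
    exact (convex_convexHull ℝ _).openSegment_subset
      (hyF (hF.left_mem_of_mem_openSegment hy hz hwF hw))
      (hzF (hF.right_mem_of_mem_openSegment hy hz hwF hw)) hw
  exact (key (hF.subset hx)).2 hx

theorem isExtreme_convexHull_inter_hyperplane {φ : E →ₗ[ℝ] ℝ} {c : ℝ} (h : ∀ y ∈ S, c ≤ φ y) :
    IsExtreme ℝ (convexHull ℝ S) (convexHull ℝ S ∩ {y | φ y = c}) := by
  have hle : convexHull ℝ S ⊆ {y | c ≤ φ y} :=
    convexHull_min h (convex_halfSpace_ge φ.isLinear c)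
  refine ⟨inter_subset_left, ?_⟩
  rintro x hx y hy _ ⟨-, hz⟩ ⟨a, b, ha, hb, hab, rfl⟩
  refine ⟨hx, ?_⟩
  have hx' : c ≤ φ x := hle hx
  have hy' : c ≤ φ y := hle hy
  simp only [mem_ofPred_eq, map_add, map_smul, smul_eq_mul] at hz ⊢
  obtain rfl : b = 1 - a := by linarith
  nlinarith [mul_nonneg hb.le (sub_nonneg.2 hy')]

theorem isExtreme_convexHull_of_supporting {φ : E →ₗ[ℝ] ℝ} {c : ℝ} (h : ∀ y ∈ S, c ≤ φ y)
    {T : Set E} (hT : S ∩ {y | φ y = c} = T) :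
    IsExtreme ℝ (convexHull ℝ S) (convexHull ℝ T) := by
  have hext := isExtreme_convexHull_inter_hyperplane h
  have hconv : Convex ℝ (convexHull ℝ S ∩ {y | φ y = c}) :=
    (convex_convexHull ℝ S).inter (convex_hyperplane φ.isLinear c)
  have heq := eq_convexHull_inter_of_isExtreme hext hconv
  rw [inter_right_comm, inter_eq_right.2 (subset_convexHull ℝ S), hT] at heq
  rwa [heq] at hext

theorem eq_or_eq_of_mem_segment_of_extreme {A : Set E} {u v w : E}
    (hw : w ∈ A.extremePoints ℝ) (hu : u ∈ A) (hv : v ∈ A) (h : w ∈ segment ℝ u v) :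
    u = w ∨ v = w :=
  (mem_extremePoints_iff_forall_segment.1 hw).2 u hu v hv h

end Faces

section Edges

variable {n : ℕ} {S E : Set (Fin n → ℝ)}

theorem adim_segment {u v : Fin n → ℝ} (h : u ≠ v) : adim (segment ℝ u v) = 1 := by
  rw [adim, ← convexHull_pair, ← direction_affineSpan, affineSpan_convexHull,
    direction_affineSpan, vectorSpan_pair, finrank_span_singleton]
  exact vsub_ne_zero.2 h

/-- An edge of a polytope is the segment between its two vertices. -/
theorem IsEdge.exists_eq_segment (hS : S ⊆ (convexHull ℝ S).extremePoints ℝ)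
    (hE : IsEdge (convexHull ℝ S) E) :
    ∃ u ∈ S, ∃ v ∈ S, u ≠ v ∧ E = segment ℝ u v ∧ ∀ w ∈ S, w ∈ E → w = u ∨ w = v := by
  obtain ⟨hext, hconv, hdim⟩ := hE
  have heq := eq_convexHull_inter_of_isExtreme hext hconv
  have hcol : Collinear ℝ E := collinear_iff_finrank_le_one.2 hdim.le
  have hnt : (E ∩ S).Nontrivial := by
    by_contra hsub
    rw [not_nontrivial_iff] at hsub
    have h0 : vectorSpan ℝ (E ∩ S) = ⊥ := vectorSpan_of_subsingleton ℝ hsub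
    rw [adim, heq, ← direction_affineSpan, affineSpan_convexHull, direction_affineSpan, h0,
      finrank_bot] at hdim
    exact zero_ne_one hdim
  obtain ⟨u, ⟨huE, hu⟩, v, ⟨hvE, hv⟩, huv⟩ := hnt
  have hall : ∀ w ∈ S, w ∈ E → w = u ∨ w = v := by
    intro w hw hwE
    have hP := subset_convexHull ℝ S
    have h3 : Collinear ℝ ({u, v, w} : Set (Fin n → ℝ)) := by
      refine hcol.subset ?_
      rintro x (rfl | rfl | rfl) <;> assumption
    rcases h3.wbtw_or_wbtw_or_wbtw with h | h | h
    · rcases eq_or_eq_of_mem_segment_of_extreme (hS hv) (hP hu) (hP hw)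
        (mem_segment_iff_wbtw.2 h) with h | h
      · exact absurd h huv
      · exact Or.inr h
    · rcases eq_or_eq_of_mem_segment_of_extreme (hS hw) (hP hv) (hP hu)
        (mem_segment_iff_wbtw.2 h) with h | h
      · exact Or.inr h.symm
      · exact Or.inl h.symm
    · rcases eq_or_eq_of_mem_segment_of_extreme (hS hu) (hP hw) (hP hv)
        (mem_segment_iff_wbtw.2 h) with h | h
      · exact Or.inl h
      · exact absurd h.symm huv
  refine ⟨u, hu, v, hv, huv, ?_, hall⟩
  have hpair : E ∩ S = {u, v} := by
    ext w
    constructor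
    · rintro ⟨hwE, hw⟩
      exact hall w hw hwE
    · rintro (rfl | rfl) <;> constructor <;> assumption
  rw [heq, hpair, convexHull_pair]

end Edges

section Certificates

variable {d : ℕ}

/-- The value at `x` of the affine functional with constant term `f.1` and linear part `f.2`. -/
def slack (f : ℤ × (Fin d → ℤ)) (x : Fin d → ℤ) : ℤ :=
  f.1 + f.2 ⬝ᵥ x

/-- The set of functionals in `F` that do not vanish at `x`, encoded as a bit mask. -/
def slackMask (F : List (ℤ × (Fin d → ℤ))) (x : Fin d → ℤ) : ℕ :=
  F.foldr (fun f m ↦ Nat.bit (slack f x != 0) m) 0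

/-- `u` and `v` are the only points of `L` on the common zero set of the functionals in `F`
vanishing at both of them. -/
def SpansFace (F : List (ℤ × (Fin d → ℤ))) (L : List (Fin d → ℤ)) (u v : Fin d → ℤ) : Prop :=
  ∀ w ∈ L, slackMask F w ||| (slackMask F u ||| slackMask F v) = slackMask F u ||| slackMask F v →
    w = u ∨ w = v

/-- The segment from `u` to `v` is crossed by a segment from `w` to `x`, with `w` and `x` in `L`,
that divides both segments in the same small ratio. -/
def IsCrossed (F : List (ℤ × (Fin d → ℤ))) (L : List (Fin d → ℤ)) (u v : Fin d → ℤ) : Prop :=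
  ∃ w ∈ L, (slackMask F w ||| (slackMask F u ||| slackMask F v) = slackMask F u ||| slackMask F v ∧
    w ≠ u ∧ w ≠ v) ∧
    ∃ x ∈ L, slackMask F w ||| slackMask F x = slackMask F u ||| slackMask F v ∧
      ∃ a ∈ [1, 2, 3], ∃ b ∈ [1, 2, 3], ∀ i, a * u i + b * v i = a * w i + b * x i

instance (F : List (ℤ × (Fin d → ℤ))) (L : List (Fin d → ℤ)) (u v : Fin d → ℤ) :
    Decidable (SpansFace F L u v) :=
  inferInstanceAs (Decidable (∀ w ∈ L, _ → _))

instance (F : List (ℤ × (Fin d → ℤ))) (L : List (Fin d → ℤ)) (u v : Fin d → ℤ) :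
    Decidable (IsCrossed F L u v) :=
  inferInstanceAs (Decidable (∃ w ∈ L, _ ∧ ∃ x ∈ L, _ ∧ ∃ a ∈ [1, 2, 3], ∃ b ∈ [1, 2, 3], _))

/-- The pairs of points of `L` that span an edge, ordered by their masks. -/
def edgePairs (F : List (ℤ × (Fin d → ℤ))) (L : List (Fin d → ℤ)) :
    List ((Fin d → ℤ) × (Fin d → ℤ)) :=
  (L ×ˢ L).filter fun p ↦ slackMask F p.1 < slackMask F p.2 ∧ SpansFace F L p.1 p.2

/-- The number of `edgePairs`, in a form suitable for evaluation. -/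
def edgeCount (F : List (ℤ × (Fin d → ℤ))) (L : List (Fin d → ℤ)) : ℕ :=
  (L.map fun u ↦ L.countP fun v ↦ slackMask F u < slackMask F v ∧ SpansFace F L u v).sum

theorem length_edgePairs (F : List (ℤ × (Fin d → ℤ))) (L : List (Fin d → ℤ)) :
    (edgePairs F L).length = edgeCount F L := by
  rw [edgePairs, ← List.countP_eq_length_filter, edgeCount]
  change List.countP _ (L.flatMap fun u ↦ L.map (Prod.mk u)) = _
  simp [List.countP_flatMap, Function.comp_def]

/-- Combinatorial data certifying that the convex hull of `L` is a `d`-polytope in which every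
point of `L` is a vertex and whose edges are the segments spanned by `edgePairs F L`. -/
structure Certifies (F : List (ℤ × (Fin d → ℤ))) (L : List (Fin d → ℤ)) : Prop where
  zero_mem : 0 ∈ L
  exists_axis : ∀ i : Fin d, ∃ x ∈ L, x i ≠ 0 ∧ ∀ j, j ≠ i → x j = 0
  slack_nonneg : ∀ x ∈ L, ∀ f ∈ F, 0 ≤ slack f x
  nodup : L.Nodup
  vertex : ∀ u ∈ L, SpansFace F L u u
  crossed : ∀ u ∈ L, ∀ v ∈ L, slackMask F u < slackMask F v → ¬ SpansFace F L u v →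
    IsCrossed F L u v

instance (F : List (ℤ × (Fin d → ℤ))) (L : List (Fin d → ℤ)) : Decidable (Certifies F L) :=
  decidable_of_iff (0 ∈ L ∧ (∀ i : Fin d, ∃ x ∈ L, x i ≠ 0 ∧ ∀ j, j ≠ i → x j = 0) ∧
      (∀ x ∈ L, ∀ f ∈ F, 0 ≤ slack f x) ∧ L.Nodup ∧ (∀ u ∈ L, SpansFace F L u u) ∧
      ∀ u ∈ L, ∀ v ∈ L, slackMask F u < slackMask F v → ¬ SpansFace F L u v → IsCrossed F L u v)
    ⟨fun ⟨h₁, h₂, h₃, h₄, h₅, h₆⟩ ↦ ⟨h₁, h₂, h₃, h₄, h₅, h₆⟩,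
      fun ⟨h₁, h₂, h₃, h₄, h₅, h₆⟩ ↦ ⟨h₁, h₂, h₃, h₄, h₅, h₆⟩⟩

theorem slackMask_lor_eq {F : List (ℤ × (Fin d → ℤ))} {u v w : Fin d → ℤ}
    (h : ∀ f ∈ F, slack f u = 0 → slack f v = 0 → slack f w = 0) :
    slackMask F w ||| (slackMask F u ||| slackMask F v) = slackMask F u ||| slackMask F v := by
  induction F with
  | nil => simp [slackMask]
  | cons f F ih =>
    have hF := ih fun g hg ↦ h g (List.mem_cons_of_mem _ hg)
    have hf := h f List.mem_cons_self
    simp only [slackMask, List.foldr_cons, Nat.lor_bit] at hF ⊢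
    rw [hF]
    congr 1
    by_cases hu : slack f u = 0 <;> by_cases hv : slack f v = 0 <;> simp_all

/-- The real vector with the given integer coordinates. -/
def realPoint (x : Fin d → ℤ) : Fin d → ℝ := fun i ↦ x i

theorem realPoint_injective : Function.Injective (realPoint (d := d)) := fun _ _ h ↦
  funext fun i ↦ Int.cast_injective (congrFun h i)

/-- The linear part of an integral affine functional. -/
noncomputable def linearPart (f : ℤ × (Fin d → ℤ)) : (Fin d → ℝ) →ₗ[ℝ] ℝ :=
  dotProductBilin ℝ ℝ (realPoint f.2)

theorem linearPart_realPoint (f : ℤ × (Fin d → ℤ)) (x : Fin d → ℤ) :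
    linearPart f (realPoint x) = slack f x - f.1 := by
  simp [linearPart, slack, realPoint, dotProduct]

variable {F : List (ℤ × (Fin d → ℤ))} {L : List (Fin d → ℤ)} {u v : Fin d → ℤ}

theorem SpansFace.isExtreme (h : SpansFace F L u v) (hpos : ∀ x ∈ L, ∀ f ∈ F, 0 ≤ slack f x)
    (hu : u ∈ L) (hv : v ∈ L) :
    IsExtreme ℝ (convexHull ℝ (realPoint '' {x | x ∈ L}))
      (segment ℝ (realPoint u) (realPoint v)) := by
  classical
  let K := F.toFinset.filter fun f ↦ slack f u = 0 ∧ slack f v = 0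
  have hval (x : Fin d → ℤ) : (∑ f ∈ K, linearPart f) (realPoint x) =
      ((∑ f ∈ K, slack f x : ℤ) : ℝ) + -∑ f ∈ K, (f.1 : ℝ) := by
    simp [LinearMap.sum_apply, linearPart_realPoint, sub_eq_add_neg, Finset.sum_add_distrib]
  have hnn : ∀ x ∈ L, ∀ f ∈ K, 0 ≤ slack f x := fun x hx f hf ↦
    hpos x hx f (List.mem_toFinset.1 (Finset.mem_filter.1 hf).1)
  rw [← convexHull_pair]
  refine isExtreme_convexHull_of_supporting (φ := ∑ f ∈ K, linearPart f)
    (c := -∑ f ∈ K, (f.1 : ℝ)) ?_ ?_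
  · rintro _ ⟨x, hx, rfl⟩
    rw [hval, le_add_iff_nonneg_left]
    exact_mod_cast Finset.sum_nonneg (hnn x hx)
  · ext y
    constructor
    · rintro ⟨⟨x, hx, rfl⟩, hy⟩
      rw [mem_ofPred_eq, hval, add_eq_right, Int.cast_eq_zero,
        Finset.sum_eq_zero_iff_of_nonneg (hnn x hx)] at hy
      have hmask := slackMask_lor_eq (F := F) (u := u) (v := v) (w := x) fun f hf hfu hfv ↦
        hy f (Finset.mem_filter.2 ⟨List.mem_toFinset.2 hf, hfu, hfv⟩)
      rcases h x hx hmask with rfl | rfl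
      · exact Or.inl rfl
      · exact Or.inr rfl
    · rintro (rfl | rfl)
      · refine ⟨mem_image_of_mem _ hu, ?_⟩
        rw [mem_ofPred_eq, hval, add_eq_right, Int.cast_eq_zero]
        exact Finset.sum_eq_zero fun f hf ↦ (Finset.mem_filter.1 hf).2.1
      · refine ⟨mem_image_of_mem _ hv, ?_⟩
        rw [mem_ofPred_eq, hval, add_eq_right, Int.cast_eq_zero]
        exact Finset.sum_eq_zero fun f hf ↦ (Finset.mem_filter.1 hf).2.2

theorem IsCrossed.exists_mem (h : IsCrossed F L u v) {E : Set (Fin d → ℝ)}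
    (hext : IsExtreme ℝ (convexHull ℝ (realPoint '' {x | x ∈ L})) E) (hconv : Convex ℝ E)
    (hu : realPoint u ∈ E) (hv : realPoint v ∈ E) :
    ∃ w ∈ L, w ≠ u ∧ w ≠ v ∧ realPoint w ∈ E := by
  obtain ⟨w, hw, ⟨-, hwu, hwv⟩, x, hx, -, a, ha, b, hb, hab⟩ := h
  have ha : (0 : ℝ) < a := by
    have : 0 < a := by revert a; simp
    exact_mod_cast this
  have hb : (0 : ℝ) < b := by
    have : 0 < b := by revert b; simp
    exact_mod_cast this
  have hP {y : Fin d → ℤ} (hy : y ∈ L) :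
      realPoint y ∈ convexHull ℝ (realPoint '' {x | x ∈ L}) :=
    subset_convexHull ℝ _ (mem_image_of_mem _ hy)
  have hsum : (a / (a + b) : ℝ) + b / (a + b) = 1 := by field_simp
  have heq : (a / (a + b) : ℝ) • realPoint u + (b / (a + b) : ℝ) • realPoint v =
      (a / (a + b) : ℝ) • realPoint w + (b / (a + b) : ℝ) • realPoint x := by
    ext i
    have hi : (a * u i + b * v i : ℝ) = a * w i + b * x i := mod_cast hab i
    simp only [Pi.add_apply, Pi.smul_apply, smul_eq_mul, realPoint]
    field_simp
    exact hi
  refine ⟨w, hw, hwu, hwv, hext.left_mem_of_mem_openSegment (hP hw) (hP hx)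
    (hconv hu hv (by positivity) (by positivity) hsum) ?_⟩
  exact ⟨_, _, by positivity, by positivity, hsum, heq.symm⟩

namespace Certifies

theorem subset_extremePoints (h : Certifies F L) :
    realPoint '' {x | x ∈ L} ⊆
      (convexHull ℝ (realPoint '' {x | x ∈ L})).extremePoints ℝ := by
  rintro _ ⟨u, hu, rfl⟩
  have := (h.vertex u hu).isExtreme h.slack_nonneg hu hu
  rwa [segment_same, isExtreme_singleton] at this

theorem adim_eq (h : Certifies F L) : adim (convexHull ℝ (realPoint '' {x | x ∈ L})) = d := by
  have htop : vectorSpan ℝ (realPoint '' {x | x ∈ L}) = ⊤ := by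
    rw [eq_top_iff, ← (Pi.basisFun ℝ (Fin d)).span_eq, Submodule.span_le]
    rintro _ ⟨i, rfl⟩
    obtain ⟨x, hx, hxi, hxj⟩ := h.exists_axis i
    have hxi : (x i : ℝ) ≠ 0 := Int.cast_ne_zero.2 hxi
    have hmem := vsub_mem_vectorSpan ℝ (mem_image_of_mem realPoint (show x ∈ {x | x ∈ L} from hx))
      (mem_image_of_mem realPoint (show 0 ∈ {x | x ∈ L} from h.zero_mem))
    have heq : Pi.basisFun ℝ (Fin d) i = (x i : ℝ)⁻¹ • (realPoint x -ᵥ realPoint 0) := by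
      ext j
      by_cases hj : j = i
      · subst hj
        simp [realPoint, hxi]
      · simp [realPoint, hxj j hj, hj]
    rw [heq]
    exact Submodule.smul_mem _ _ hmem
  rw [adim, ← direction_affineSpan, affineSpan_convexHull, direction_affineSpan, htop, finrank_top,
    Module.finrank_fin_fun]

theorem eq_of_slackMask_eq (h : Certifies F L) (hu : u ∈ L) (hv : v ∈ L)
    (huv : slackMask F u = slackMask F v) : u = v := by
  simpa using h.vertex v hv u hu (by rw [huv, Nat.or_self, Nat.or_self])

theorem mem_edgePairs {p : (Fin d → ℤ) × (Fin d → ℤ)} :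
    p ∈ edgePairs F L ↔ (p.1 ∈ L ∧ p.2 ∈ L) ∧ slackMask F p.1 < slackMask F p.2 ∧
      SpansFace F L p.1 p.2 := by
  obtain ⟨u, v⟩ := p
  simp [edgePairs, List.mem_filter]

theorem setOf_isEdge (h : Certifies F L) :
    {E | IsEdge (convexHull ℝ (realPoint '' {x | x ∈ L})) E} =
      (fun p ↦ segment ℝ (realPoint p.1) (realPoint p.2)) '' {p | p ∈ edgePairs F L} := by
  ext E
  constructor
  · intro hE
    have key : ∀ u ∈ L, ∀ v ∈ L, slackMask F u < slackMask F v →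
        E = segment ℝ (realPoint u) (realPoint v) →
        (∀ w ∈ L, realPoint w ∈ E → w = u ∨ w = v) → (u, v) ∈ edgePairs F L := by
      intro u hu v hv hlt hseg hall
      refine mem_edgePairs.2 ⟨⟨hu, hv⟩, hlt, ?_⟩
      by_contra hface
      obtain ⟨w, hw, hwu, hwv, hwE⟩ := (h.crossed u hu v hv hlt hface).exists_mem hE.1 hE.2.1
        (hseg ▸ left_mem_segment ℝ _ _) (hseg ▸ right_mem_segment ℝ _ _)
      exact (hall w hw hwE).elim hwu hwv
    obtain ⟨_, ⟨u, hu, rfl⟩, _, ⟨v, hv, rfl⟩, huv, hseg, hall⟩ :=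
      IsEdge.exists_eq_segment h.subset_extremePoints hE
    have hall' : ∀ w ∈ L, realPoint w ∈ E → w = u ∨ w = v := fun w hw hwE ↦
      (hall _ (mem_image_of_mem _ hw) hwE).imp (fun h ↦ realPoint_injective h)
        (fun h ↦ realPoint_injective h)
    rcases lt_trichotomy (slackMask F u) (slackMask F v) with hlt | heq | hlt
    · exact ⟨(u, v), key u hu v hv hlt hseg hall', hseg.symm⟩
    · exact absurd (congrArg realPoint (h.eq_of_slackMask_eq hu hv heq)) huv
    · rw [segment_symm] at hseg
      exact ⟨(v, u), key v hv u hu hlt hseg fun w hw hwE ↦ (hall' w hw hwE).symm, hseg.symm⟩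
  · rintro ⟨⟨u, v⟩, hp, rfl⟩
    obtain ⟨⟨hu, hv⟩, hlt, hface⟩ := mem_edgePairs.1 hp
    refine ⟨hface.isExtreme h.slack_nonneg hu hv, convex_segment _ _, adim_segment fun huv ↦ ?_⟩
    have huv : u = v := realPoint_injective huv
    simp [huv] at hlt

theorem injOn_segment (h : Certifies F L) :
    InjOn (fun p : (Fin d → ℤ) × (Fin d → ℤ) ↦ segment ℝ (realPoint p.1) (realPoint p.2))
      {p | p ∈ edgePairs F L} := by
  have key : ∀ {u v w}, u ∈ L → v ∈ L → w ∈ L →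
      realPoint w ∈ segment ℝ (realPoint u) (realPoint v) → u = w ∨ v = w := by
    intro u v w hu hv hw hmem
    exact (eq_or_eq_of_mem_segment_of_extreme (h.subset_extremePoints (mem_image_of_mem _ hw))
      (subset_convexHull ℝ _ (mem_image_of_mem _ hu))
      (subset_convexHull ℝ _ (mem_image_of_mem _ hv)) hmem).imp
      (fun h ↦ realPoint_injective h) (fun h ↦ realPoint_injective h)
  rintro ⟨u, v⟩ hp ⟨u', v'⟩ hp' heq
  obtain ⟨⟨hu, hv⟩, hlt, -⟩ := mem_edgePairs.1 hp
  obtain ⟨⟨hu', hv'⟩, hlt', -⟩ := mem_edgePairs.1 hp'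
  dsimp only at *
  have h₁ := key hu' hv' hu (heq ▸ left_mem_segment ℝ _ _)
  have h₂ := key hu' hv' hv (heq ▸ right_mem_segment ℝ _ _)
  rcases h₁ with rfl | rfl <;> rcases h₂ with rfl | rfl
  · exact absurd hlt (lt_irrefl _)
  · rfl
  · exact absurd hlt' hlt.asymm
  · exact absurd hlt (lt_irrefl _)

theorem mem_fPairs (h : Certifies F L) : (L.length, edgeCount F L) ∈ fPairs d := by
  classical
  have hcoe : {x | x ∈ L} = (L.toFinset : Set (Fin d → ℤ)) := by ext; simp
  refine ⟨d, convexHull ℝ (realPoint '' {x | x ∈ L}), ⟨⟨L.toFinset.image realPoint, ?_⟩,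
    h.adim_eq⟩, ?_, ?_⟩
  · rw [Finset.coe_image, hcoe]
  · rw [f₀, extremePoints_convexHull_subset.antisymm h.subset_extremePoints,
      ncard_image_of_injective _ realPoint_injective, hcoe, ncard_coe_finset,
      List.toFinset_card_of_nodup h.nodup]
  · have hnodup : (edgePairs F L).Nodup := (h.nodup.product h.nodup).filter _
    have hcoe' : {p | p ∈ edgePairs F L} = ((edgePairs F L).toFinset : Set _) := by ext; simp
    rw [f₁, h.setOf_isEdge, h.injOn_segment.ncard_image, hcoe', ncard_coe_finset,
      List.toFinset_card_of_nodup hnodup, length_edgePairs]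

end Certifies

end Certificates

section Examples

/-- The functionals that read off a coordinate. -/
def coordFunctionals : List (ℤ × (Fin 6 → ℤ)) :=
  (List.finRange 6).map fun i ↦ (0, Pi.single i 1)

/-- Facet inequalities, besides nonnegativity of the coordinates, of the product of a triangle and
a 4-simplex. -/
def productTwoFourFacets : List (ℤ × (Fin 6 → ℤ)) :=
  [(1, ![-1, -1, 0, 0, 0, 0]), (1, ![0, 0, -1, -1, -1, -1])]

/-- The vertices of the product of a triangle and a 4-simplex. -/
def productTwoFourVertices : List (Fin 6 → ℤ) :=
  [![0, 0, 0, 0, 0, 0], ![0, 0, 0, 0, 0, 1], ![0, 0, 0, 0, 1, 0], ![0, 0, 0, 1, 0, 0],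
   ![0, 0, 1, 0, 0, 0], ![0, 1, 0, 0, 0, 0], ![0, 1, 0, 0, 0, 1], ![0, 1, 0, 0, 1, 0],
   ![0, 1, 0, 1, 0, 0], ![0, 1, 1, 0, 0, 0], ![1, 0, 0, 0, 0, 0], ![1, 0, 0, 0, 0, 1],
   ![1, 0, 0, 0, 1, 0], ![1, 0, 0, 1, 0, 0], ![1, 0, 1, 0, 0, 0]]

/-- Facet inequalities, besides nonnegativity of the coordinates, of the pyramid over a 5-simplex
truncated at two vertices. -/
def pyramidTruncatedSimplexFacets : List (ℤ × (Fin 6 → ℤ)) :=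
  [(3, ![-1, -1, -1, -1, -1, -1]), (6, ![-3, 0, 0, 0, 0, -2]), (6, ![0, -3, 0, 0, 0, -2])]

/-- The vertices of the pyramid over a 5-simplex truncated at two vertices. -/
def pyramidTruncatedSimplexVertices : List (Fin 6 → ℤ) :=
  [![0, 0, 0, 0, 0, 0], ![0, 0, 0, 0, 0, 3], ![0, 0, 0, 0, 3, 0], ![0, 0, 0, 3, 0, 0],
   ![0, 0, 3, 0, 0, 0], ![0, 2, 0, 0, 0, 0], ![0, 2, 0, 0, 1, 0], ![0, 2, 0, 1, 0, 0],
   ![0, 2, 1, 0, 0, 0], ![1, 2, 0, 0, 0, 0], ![2, 0, 0, 0, 0, 0], ![2, 0, 0, 0, 1, 0],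
   ![2, 0, 0, 1, 0, 0], ![2, 0, 1, 0, 0, 0], ![2, 1, 0, 0, 0, 0]]

/-- Facet inequalities, besides nonnegativity of the coordinates, of the product of two
tetrahedra. -/
def productThreeThreeFacets : List (ℤ × (Fin 6 → ℤ)) :=
  [(1, ![-1, -1, -1, 0, 0, 0]), (1, ![0, 0, 0, -1, -1, -1])]

/-- The vertices of the product of two tetrahedra. -/
def productThreeThreeVertices : List (Fin 6 → ℤ) :=
  [![0, 0, 0, 0, 0, 0], ![0, 0, 0, 0, 0, 1], ![0, 0, 0, 0, 1, 0], ![0, 0, 0, 1, 0, 0],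
   ![0, 0, 1, 0, 0, 0], ![0, 0, 1, 0, 0, 1], ![0, 0, 1, 0, 1, 0], ![0, 0, 1, 1, 0, 0],
   ![0, 1, 0, 0, 0, 0], ![0, 1, 0, 0, 0, 1], ![0, 1, 0, 0, 1, 0], ![0, 1, 0, 1, 0, 0],
   ![1, 0, 0, 0, 0, 0], ![1, 0, 0, 0, 0, 1], ![1, 0, 0, 0, 1, 0], ![1, 0, 0, 1, 0, 0]]

/-- Facet inequalities, besides nonnegativity of the coordinates, of the threefold pyramid over a
triangular prism, truncated along a lateral edge of the prism. -/
def truncatedPyramidPrismFacets : List (ℤ × (Fin 6 → ℤ)) :=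
  [(2, ![-1, 0, 0, -1, -1, -1]), (2, ![0, -1, -1, -1, -1, -1]), (1, ![0, -1, 0, 0, 0, 0])]

/-- The vertices of the threefold pyramid over a triangular prism, truncated along a lateral edge
of the prism. -/
def truncatedPyramidPrismVertices : List (Fin 6 → ℤ) :=
  [![0, 0, 0, 0, 0, 0], ![0, 0, 0, 0, 0, 2], ![0, 0, 0, 0, 2, 0], ![0, 0, 0, 2, 0, 0],
   ![0, 0, 2, 0, 0, 0], ![0, 1, 0, 0, 0, 0], ![0, 1, 0, 0, 0, 1], ![0, 1, 0, 0, 1, 0],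
   ![0, 1, 0, 1, 0, 0], ![0, 1, 1, 0, 0, 0], ![1, 1, 0, 0, 0, 1], ![1, 1, 0, 0, 1, 0],
   ![1, 1, 0, 1, 0, 0], ![2, 0, 0, 0, 0, 0], ![2, 0, 2, 0, 0, 0], ![2, 1, 0, 0, 0, 0],
   ![2, 1, 1, 0, 0, 0]]

/-- Facet inequalities, besides nonnegativity of the coordinates, of the pyramid over the prism
over a 4-simplex, truncated along one lateral edge of the prism. -/
def truncatedPyramidOneFacets : List (ℤ × (Fin 6 → ℤ)) :=
  [(3, ![-1, 0, 0, 0, 0, -1]), (3, ![0, -1, -1, -1, -1, -1]), (2, ![0, -1, 0, 0, 0, 0])]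

/-- The vertices of the pyramid over the prism over a 4-simplex, truncated along one lateral edge
of the prism. -/
def truncatedPyramidOneVertices : List (Fin 6 → ℤ) :=
  [![0, 0, 0, 0, 0, 0], ![0, 0, 0, 0, 0, 3], ![0, 0, 0, 0, 3, 0], ![0, 0, 0, 3, 0, 0],
   ![0, 0, 3, 0, 0, 0], ![0, 2, 0, 0, 0, 0], ![0, 2, 0, 0, 0, 1], ![0, 2, 0, 0, 1, 0],
   ![0, 2, 0, 1, 0, 0], ![0, 2, 1, 0, 0, 0], ![2, 2, 0, 0, 0, 1], ![3, 0, 0, 0, 0, 0],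
   ![3, 0, 0, 0, 3, 0], ![3, 0, 0, 3, 0, 0], ![3, 0, 3, 0, 0, 0], ![3, 2, 0, 0, 0, 0],
   ![3, 2, 0, 0, 1, 0], ![3, 2, 0, 1, 0, 0], ![3, 2, 1, 0, 0, 0]]

/-- Facet inequalities, besides nonnegativity of the coordinates, of the product of a triangle and
a 4-simplex, truncated along an edge. -/
def truncatedProductFacets : List (ℤ × (Fin 6 → ℤ)) :=
  [(2, ![-1, -1, 0, 0, 0, 0]), (2, ![0, 0, -1, -1, -1, -1]), (1, ![0, 1, -1, 0, 0, 0])]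

/-- The vertices of the product of a triangle and a 4-simplex, truncated along an edge. -/
def truncatedProductVertices : List (Fin 6 → ℤ) :=
  [![0, 0, 0, 0, 0, 0], ![0, 0, 0, 0, 0, 2], ![0, 0, 0, 0, 2, 0], ![0, 0, 0, 2, 0, 0],
   ![0, 0, 1, 0, 0, 0], ![0, 0, 1, 0, 0, 1], ![0, 0, 1, 0, 1, 0], ![0, 0, 1, 1, 0, 0],
   ![0, 1, 2, 0, 0, 0], ![0, 2, 0, 0, 0, 0], ![0, 2, 0, 0, 0, 2], ![0, 2, 0, 0, 2, 0],
   ![0, 2, 0, 2, 0, 0], ![0, 2, 2, 0, 0, 0], ![1, 1, 2, 0, 0, 0], ![2, 0, 0, 0, 0, 0],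
   ![2, 0, 0, 0, 0, 2], ![2, 0, 0, 0, 2, 0], ![2, 0, 0, 2, 0, 0], ![2, 0, 1, 0, 0, 0],
   ![2, 0, 1, 0, 0, 1], ![2, 0, 1, 0, 1, 0], ![2, 0, 1, 1, 0, 0]]

/-- Facet inequalities, besides nonnegativity of the coordinates, of the product of a segment, a
triangle and a tetrahedron. -/
def productOneTwoThreeFacets : List (ℤ × (Fin 6 → ℤ)) :=
  [(1, ![-1, 0, 0, 0, 0, 0]), (1, ![0, -1, -1, 0, 0, 0]), (1, ![0, 0, 0, -1, -1, -1])]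

/-- The vertices of the product of a segment, a triangle and a tetrahedron. -/
def productOneTwoThreeVertices : List (Fin 6 → ℤ) :=
  [![0, 0, 0, 0, 0, 0], ![0, 0, 0, 0, 0, 1], ![0, 0, 0, 0, 1, 0], ![0, 0, 0, 1, 0, 0],
   ![0, 0, 1, 0, 0, 0], ![0, 0, 1, 0, 0, 1], ![0, 0, 1, 0, 1, 0], ![0, 0, 1, 1, 0, 0],
   ![0, 1, 0, 0, 0, 0], ![0, 1, 0, 0, 0, 1], ![0, 1, 0, 0, 1, 0], ![0, 1, 0, 1, 0, 0],
   ![1, 0, 0, 0, 0, 0], ![1, 0, 0, 0, 0, 1], ![1, 0, 0, 0, 1, 0], ![1, 0, 0, 1, 0, 0],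
   ![1, 0, 1, 0, 0, 0], ![1, 0, 1, 0, 0, 1], ![1, 0, 1, 0, 1, 0], ![1, 0, 1, 1, 0, 0],
   ![1, 1, 0, 0, 0, 0], ![1, 1, 0, 0, 0, 1], ![1, 1, 0, 0, 1, 0], ![1, 1, 0, 1, 0, 0]]

/-- Facet inequalities, besides nonnegativity of the coordinates, of the pyramid over the prism
over a 4-simplex, truncated along two lateral edges of the prism. -/
def truncatedPyramidTwoFacets : List (ℤ × (Fin 6 → ℤ)) :=
  [(3, ![-1, 0, 0, 0, 0, -1]), (3, ![0, -1, -1, -1, -1, -1]), (2, ![0, -1, 0, 0, 0, 0]),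
   (2, ![0, 0, -1, 0, 0, 0])]

/-- The vertices of the pyramid over the prism over a 4-simplex, truncated along two lateral edges
of the prism. -/
def truncatedPyramidTwoVertices : List (Fin 6 → ℤ) :=
  [![0, 0, 0, 0, 0, 0], ![0, 0, 0, 0, 0, 3], ![0, 0, 0, 0, 3, 0], ![0, 0, 0, 3, 0, 0],
   ![0, 0, 2, 0, 0, 0], ![0, 0, 2, 0, 0, 1], ![0, 0, 2, 0, 1, 0], ![0, 0, 2, 1, 0, 0],
   ![0, 1, 2, 0, 0, 0], ![0, 2, 0, 0, 0, 0], ![0, 2, 0, 0, 0, 1], ![0, 2, 0, 0, 1, 0],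
   ![0, 2, 0, 1, 0, 0], ![0, 2, 1, 0, 0, 0], ![2, 0, 2, 0, 0, 1], ![2, 2, 0, 0, 0, 1],
   ![3, 0, 0, 0, 0, 0], ![3, 0, 0, 0, 3, 0], ![3, 0, 0, 3, 0, 0], ![3, 0, 2, 0, 0, 0],
   ![3, 0, 2, 0, 1, 0], ![3, 0, 2, 1, 0, 0], ![3, 1, 2, 0, 0, 0], ![3, 2, 0, 0, 0, 0],
   ![3, 2, 0, 0, 1, 0], ![3, 2, 0, 1, 0, 0], ![3, 2, 1, 0, 0, 0]]

/-- Facet inequalities, besides nonnegativity of the coordinates, of the pyramid over the prism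
over a 4-simplex, truncated along three lateral edges of the prism. -/
def truncatedPyramidThreeFacets : List (ℤ × (Fin 6 → ℤ)) :=
  [(3, ![-1, 0, 0, 0, 0, -1]), (3, ![0, -1, -1, -1, -1, -1]), (2, ![0, -1, 0, 0, 0, 0]),
   (2, ![0, 0, -1, 0, 0, 0]), (2, ![0, 0, 0, -1, 0, 0])]

/-- The vertices of the pyramid over the prism over a 4-simplex, truncated along three lateral
edges of the prism. -/
def truncatedPyramidThreeVertices : List (Fin 6 → ℤ) :=
  [![0, 0, 0, 0, 0, 0], ![0, 0, 0, 0, 0, 3], ![0, 0, 0, 0, 3, 0], ![0, 0, 0, 2, 0, 0],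
   ![0, 0, 0, 2, 0, 1], ![0, 0, 0, 2, 1, 0], ![0, 0, 1, 2, 0, 0], ![0, 0, 2, 0, 0, 0],
   ![0, 0, 2, 0, 0, 1], ![0, 0, 2, 0, 1, 0], ![0, 0, 2, 1, 0, 0], ![0, 1, 0, 2, 0, 0],
   ![0, 1, 2, 0, 0, 0], ![0, 2, 0, 0, 0, 0], ![0, 2, 0, 0, 0, 1], ![0, 2, 0, 0, 1, 0],
   ![0, 2, 0, 1, 0, 0], ![0, 2, 1, 0, 0, 0], ![2, 0, 0, 2, 0, 1], ![2, 0, 2, 0, 0, 1],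
   ![2, 2, 0, 0, 0, 1], ![3, 0, 0, 0, 0, 0], ![3, 0, 0, 0, 3, 0], ![3, 0, 0, 2, 0, 0],
   ![3, 0, 0, 2, 1, 0], ![3, 0, 1, 2, 0, 0], ![3, 0, 2, 0, 0, 0], ![3, 0, 2, 0, 1, 0],
   ![3, 0, 2, 1, 0, 0], ![3, 1, 0, 2, 0, 0], ![3, 1, 2, 0, 0, 0], ![3, 2, 0, 0, 0, 0],
   ![3, 2, 0, 0, 1, 0], ![3, 2, 0, 1, 0, 0], ![3, 2, 1, 0, 0, 0]]

theorem product_two_four_mem_fPairs : (15, 45) ∈ fPairs 6 := by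
  have h : Certifies (coordFunctionals ++ productTwoFourFacets)
      productTwoFourVertices := by
    decide +kernel
  have hq : edgeCount (coordFunctionals ++ productTwoFourFacets)
      productTwoFourVertices = 45 := by
    decide +kernel
  exact hq ▸ h.mem_fPairs

theorem pyramidTruncatedSimplex_mem_fPairs : (15, 49) ∈ fPairs 6 := by
  have h : Certifies (coordFunctionals ++ pyramidTruncatedSimplexFacets)
      pyramidTruncatedSimplexVertices := by
    decide +kernel
  have hq : edgeCount (coordFunctionals ++ pyramidTruncatedSimplexFacets)
      pyramidTruncatedSimplexVertices = 49 := by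
    decide +kernel
  exact hq ▸ h.mem_fPairs

theorem product_three_three_mem_fPairs : (16, 48) ∈ fPairs 6 := by
  have h : Certifies (coordFunctionals ++ productThreeThreeFacets)
      productThreeThreeVertices := by
    decide +kernel
  have hq : edgeCount (coordFunctionals ++ productThreeThreeFacets)
      productThreeThreeVertices = 48 := by
    decide +kernel
  exact hq ▸ h.mem_fPairs

theorem truncatedPyramidPrism_mem_fPairs : (17, 54) ∈ fPairs 6 := by
  have h : Certifies (coordFunctionals ++ truncatedPyramidPrismFacets)
      truncatedPyramidPrismVertices := by
    decide +kernel
  have hq : edgeCount (coordFunctionals ++ truncatedPyramidPrismFacets)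
      truncatedPyramidPrismVertices = 54 := by
    decide +kernel
  exact hq ▸ h.mem_fPairs

theorem truncatedPyramid_one_mem_fPairs : (19, 59) ∈ fPairs 6 := by
  have h : Certifies (coordFunctionals ++ truncatedPyramidOneFacets)
      truncatedPyramidOneVertices := by
    decide +kernel
  have hq : edgeCount (coordFunctionals ++ truncatedPyramidOneFacets)
      truncatedPyramidOneVertices = 59 := by
    decide +kernel
  exact hq ▸ h.mem_fPairs

theorem truncatedProduct_mem_fPairs : (23, 69) ∈ fPairs 6 := by
  have h : Certifies (coordFunctionals ++ truncatedProductFacets)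
      truncatedProductVertices := by
    decide +kernel
  have hq : edgeCount (coordFunctionals ++ truncatedProductFacets)
      truncatedProductVertices = 69 := by
    decide +kernel
  exact hq ▸ h.mem_fPairs

theorem product_one_two_three_mem_fPairs : (24, 72) ∈ fPairs 6 := by
  have h : Certifies (coordFunctionals ++ productOneTwoThreeFacets)
      productOneTwoThreeVertices := by
    decide +kernel
  have hq : edgeCount (coordFunctionals ++ productOneTwoThreeFacets)
      productOneTwoThreeVertices = 72 := by
    decide +kernel
  exact hq ▸ h.mem_fPairs

theorem truncatedPyramid_two_mem_fPairs : (27, 83) ∈ fPairs 6 := by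
  have h : Certifies (coordFunctionals ++ truncatedPyramidTwoFacets)
      truncatedPyramidTwoVertices := by
    decide +kernel
  have hq : edgeCount (coordFunctionals ++ truncatedPyramidTwoFacets)
      truncatedPyramidTwoVertices = 83 := by
    decide +kernel
  exact hq ▸ h.mem_fPairs

theorem truncatedPyramid_three_mem_fPairs : (35, 107) ∈ fPairs 6 := by
  have h : Certifies (coordFunctionals ++ truncatedPyramidThreeFacets)
      truncatedPyramidThreeVertices := by
    decide +kernel
  have hq : edgeCount (coordFunctionals ++ truncatedPyramidThreeFacets)
      truncatedPyramidThreeVertices = 107 := by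
    decide +kernel
  exact hq ▸ h.mem_fPairs

end Examples

/-- Each of the pairs `(15,45), (15,49), (16,48), (17,54), (19,59), (23,69), (24,72),
(27,83), (35,107)` is realized by a 6-polytope. -/
theorem stmt9 :
    (15, 45) ∈ fPairs 6 ∧ (15, 49) ∈ fPairs 6 ∧ (16, 48) ∈ fPairs 6 ∧
    (17, 54) ∈ fPairs 6 ∧ (19, 59) ∈ fPairs 6 ∧ (23, 69) ∈ fPairs 6 ∧
    (24, 72) ∈ fPairs 6 ∧ (27, 83) ∈ fPairs 6 ∧ (35, 107) ∈ fPairs 6 :=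
  ⟨product_two_four_mem_fPairs, pyramidTruncatedSimplex_mem_fPairs, product_three_three_mem_fPairs,
    truncatedPyramidPrism_mem_fPairs, truncatedPyramid_one_mem_fPairs, truncatedProduct_mem_fPairs,
    product_one_two_three_mem_fPairs, truncatedPyramid_two_mem_fPairs,
    truncatedPyramid_three_mem_fPairs⟩
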